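/- arXiv:1004.2603 — 2 statements merged into one kernel-verified Lean document; each statement's English description precedes it below -/
import Mathlib

section
/- Let k and k′ be algebraically closed fields of characteristic zero and n ≥ 2. If K is a finite subgroup of PGL(n,k), then there exists a finite subgroup K′ of PGL(n,k′) isomorphic to K as an abstract group. -/
open Matrix

/-- The projective general linear group `PGL(n,k) = GL(n,k)` modulo its center (the scalar
matrices, for `k` a field). -/
abbrev PGL (n : ℕ) (k : Type*) [Field k] :=
  GL (Fin n) k ⧸ Subgroup.center (GL (Fin n) k)

/-- A finite-type `ℚ`-algebra has a point in any algebraically closed field of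
characteristic zero. -/
theorem exists_ringHom_of_finiteType (A : Type*) (k' : Type*) [CommRing A] [Nontrivial A]
    [Algebra ℚ A] [Algebra.FiniteType ℚ A] [Field k'] [IsAlgClosed k'] [CharZero k'] :
    Nonempty (A →+* k') := by
  obtain ⟨m, hm⟩ := Ideal.exists_maximal A
  let := Ideal.Quotient.field m
  have := finite_of_finite_type_of_isJacobsonRing ℚ (A ⧸ m)
  have f : (A ⧸ m) →ₐ[ℚ] k' := IsAlgClosed.lift
  exact ⟨f.toRingHom.comp (Ideal.Quotient.mk m)⟩

/-- An invertible matrix whose entries, and those of its inverse, lie in a subalgebra, lifts. -/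
theorem exists_GL_lift {k : Type*} [Field k] [Algebra ℚ k] {n : ℕ} (A : Subalgebra ℚ k)
    (M : GL (Fin n) k) (h1 : ∀ i j, M.val i j ∈ A) (h2 : ∀ i j, (M⁻¹).val i j ∈ A) :
    ∃ N : GL (Fin n) A,
      Matrix.GeneralLinearGroup.map (A.val : A →ₐ[ℚ] k).toRingHom N = M := by
  let X : Matrix (Fin n) (Fin n) A := fun i j => ⟨M.val i j, h1 i j⟩
  let Y : Matrix (Fin n) (Fin n) A := fun i j => ⟨(M⁻¹).val i j, h2 i j⟩
  have hinj : Function.Injective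
      (RingHom.mapMatrix (m := Fin n) (A.val : A →ₐ[ℚ] k).toRingHom) :=
    Matrix.map_injective Subtype.val_injective
  have hX : RingHom.mapMatrix (A.val : A →ₐ[ℚ] k).toRingHom X = M.val := rfl
  have hY : RingHom.mapMatrix (A.val : A →ₐ[ℚ] k).toRingHom Y = (M⁻¹).val := rfl
  refine ⟨⟨X, Y, hinj ?_, hinj ?_⟩, Units.ext hX⟩
  · rw [map_mul, hX, hY, map_one, Units.mul_inv]
  · rw [map_mul, hX, hY, map_one, Units.inv_mul]

/-- Let `k` and `k′` be algebraically closed fields of characteristic zero and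
`n ≥ 2`.  If `K` is a finite subgroup of `PGL(n,k)`, then there is a finite subgroup `K′` of
`PGL(n,k′)` isomorphic to `K` as an abstract group. -/
theorem finite_subgroup_PGL_transfer
    {k k' : Type*} [Field k] [IsAlgClosed k] [CharZero k]
    [Field k'] [IsAlgClosed k'] [CharZero k']
    (n : ℕ) (hn : 2 ≤ n)
    (K : Subgroup (PGL n k)) (hK : Finite K) :
    ∃ K' : Subgroup (PGL n k'), Finite K' ∧ Nonempty (K ≃* K') := by
  classical
  have hg : ∀ a : K, ∃ g : GL (Fin n) k, (QuotientGroup.mk g : PGL n k) = a :=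
    fun a => QuotientGroup.mk_surjective _
  choose g hg using hg
  have hw : ∀ a : K, ∃ (h : GL (Fin n) k) (i j : Fin n), a ≠ 1 →
      (g a * h).val i j - (h * g a).val i j ≠ 0 := by
    intro a
    by_cases ha : a = 1
    · exact ⟨1, ⟨0, by omega⟩, ⟨0, by omega⟩, fun h => absurd ha h⟩
    · by_contra! hcon
      apply ha
      apply Subtype.ext
      rw [← hg a]
      refine (QuotientGroup.eq_one_iff _).2 (Subgroup.mem_center_iff.2 fun h => ?_)
      ext i j
      exact (sub_eq_zero.1 (hcon h i j).2).symm
  choose h i j hw using hw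
  let w : K → k := fun a => (g a * h a).val (i a) (j a) - (h a * g a).val (i a) (j a)
  let T1 : Set k := Set.range fun p : K × Fin n × Fin n => (g p.1).val p.2.1 p.2.2
  let T2 : Set k := Set.range fun p : K × Fin n × Fin n => ((g p.1)⁻¹).val p.2.1 p.2.2
  let T3 : Set k := Set.range fun p : K × Fin n × Fin n => (h p.1).val p.2.1 p.2.2
  let T4 : Set k := Set.range fun p : K × Fin n × Fin n => ((h p.1)⁻¹).val p.2.1 p.2.2
  let T5 : Set k := Set.range fun a : K => (w a)⁻¹
  let S : Set k := T1 ∪ T2 ∪ T3 ∪ T4 ∪ T5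
  have hS : S.Finite :=
    ((((Set.finite_range _).union (Set.finite_range _)).union (Set.finite_range _)).union
      (Set.finite_range _)).union (Set.finite_range _)
  let A : Subalgebra ℚ k := Algebra.adjoin ℚ S
  have hA : Algebra.FiniteType ℚ A :=
    (Subalgebra.fg_iff_finiteType A).1 (Subalgebra.fg_def.2 ⟨S, hS, rfl⟩)
  have hSA : ∀ x ∈ S, x ∈ A := fun x hx => Algebra.subset_adjoin hx
  have hG := fun a : K => exists_GL_lift A (g a)
    (fun p q => hSA _ (Or.inl <| Or.inl <| Or.inl <| Or.inl ⟨(a, p, q), rfl⟩))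
    (fun p q => hSA _ (Or.inl <| Or.inl <| Or.inl <| Or.inr ⟨(a, p, q), rfl⟩))
  have hH := fun a : K => exists_GL_lift A (h a)
    (fun p q => hSA _ (Or.inl <| Or.inl <| Or.inr ⟨(a, p, q), rfl⟩))
    (fun p q => hSA _ (Or.inl <| Or.inr ⟨(a, p, q), rfl⟩))
  choose G hG using hG
  choose H hH using hH
  obtain ⟨φ⟩ := exists_ringHom_of_finiteType A k'
  let ι : A →+* k := (A.val : A →ₐ[ℚ] k).toRingHom
  have hι : Function.Injective ι := Subtype.val_injective
  have hmι : Function.Injective (Matrix.GeneralLinearGroup.map (n := Fin n) ι) := by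
    intro x y hxy
    ext p q
    have := congrArg (fun M : GL (Fin n) k => M.val p q) hxy
    exact congrArg Subtype.val (hι this)
  let Φ := Matrix.GeneralLinearGroup.map (n := Fin n) φ
  let f : K →* PGL n k' := MonoidHom.mk' (fun a => QuotientGroup.mk (Φ (G a))) (by
    intro a b
    rw [← QuotientGroup.mk_mul, QuotientGroup.eq, ← map_mul, ← map_inv, ← map_mul]
    apply Matrix.GeneralLinearGroup.map_center_le φ
    have hc : (g (a * b))⁻¹ * (g a * g b) ∈ Subgroup.center (GL (Fin n) k) := by
      rw [← QuotientGroup.eq, QuotientGroup.mk_mul, hg, hg, hg]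
      rfl
    refine Subgroup.mem_center_iff.2 fun x => hmι ?_
    have := Subgroup.mem_center_iff.1 hc (Matrix.GeneralLinearGroup.map ι x)
    simp only [map_mul, map_inv]
    rw [hG, hG, hG]
    exact this)
  have hf : Function.Injective f := by
    rw [injective_iff_map_eq_one]
    intro a ha
    by_contra hne
    have hc : Φ (G a) ∈ Subgroup.center (GL (Fin n) k') := (QuotientGroup.eq_one_iff _).1 ha
    have hcomm := Subgroup.mem_center_iff.1 hc (Φ (H a))
    let W : A := (G a * H a).val (i a) (j a) - (H a * G a).val (i a) (j a)
    have hW : ι W = w a := by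
      have e1 : Matrix.GeneralLinearGroup.map ι (G a * H a) = g a * h a := by
        rw [map_mul]; exact congrArg₂ _ (hG a) (hH a)
      have e2 : Matrix.GeneralLinearGroup.map ι (H a * G a) = h a * g a := by
        rw [map_mul]; exact congrArg₂ _ (hH a) (hG a)
      simp only [W, w, map_sub, ← e1, ← e2]
      rfl
    have hW0 : φ W = 0 := by
      rw [map_sub, sub_eq_zero]
      rw [← map_mul, ← map_mul] at hcomm
      exact (congrArg (fun M : GL (Fin n) k' => M.val (i a) (j a)) hcomm).symm
    let V : A := ⟨(w a)⁻¹, hSA _ (Or.inr ⟨a, rfl⟩)⟩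
    have hWV : W * V = 1 := by
      apply hι
      rw [map_mul, hW, map_one]
      exact mul_inv_cancel₀ (hw a hne)
    have := congrArg φ hWV
    rw [map_mul, hW0, zero_mul, map_one] at this
    exact zero_ne_one this
  exact ⟨f.range, Finite.of_equiv K (MonoidHom.ofInjective hf).toEquiv, ⟨MonoidHom.ofInjective hf⟩⟩
end

section
/- Every finite subgroup of PGL(2,k), for k an algebraically closed field of characteristic zero, is isomorphic to one of: the alternating group A₅, the symmetric group S₄, the alternating group A₄, a dihedral group D₂ν of order 2ν with ν ≥ 2, or a cyclic group Z_ν with ν ≥ 1. -/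
open Matrix

theorem dihedral_of_index_two {G : Type*} [Group G] [Finite G] (C : Subgroup G) (hC : IsCyclic C)
    (hi : C.index = 2) (hs : ∀ g, g ∉ C → g * g = 1) :
    Nonempty (G ≃* DihedralGroup (Nat.card C)) := by
  have hcard := C.card_mul_index
  rw [hi] at hcard
  obtain ⟨s, hsC⟩ : ∃ s, s ∉ C := by
    by_contra! h
    have : C = ⊤ := by ext; simp [h]
    rw [this] at hi; simp at hi
  let φ := zmodCyclicMulEquiv hC
  let ψ : ZMod (Nat.card C) → G := fun i => (φ (Multiplicative.ofAdd i) : G)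
  have hψC : ∀ i, ψ i ∈ C := fun i => (φ (Multiplicative.ofAdd i)).2
  have hadd : ∀ i j, ψ (i + j) = ψ i * ψ j := by intro i j; simp [ψ, ofAdd_add]
  have hneg : ∀ i, ψ (-i) = (ψ i)⁻¹ := by intro i; simp [ψ, ofAdd_neg]
  have hinj : Function.Injective ψ := by
    intro i j h
    exact Multiplicative.ofAdd.injective (φ.injective (Subtype.ext h))
  have hnot : ∀ i, s * ψ i ∉ C := fun i h => hsC ((C.mul_mem_cancel_right (hψC i)).1 h)
  have hss : s * s = 1 := hs s hsC
  have hrel : ∀ i, ψ i * s = s * ψ (-i) := by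
    intro i
    have h := hs _ (hnot i)
    rw [hneg]
    have h2 : s * (ψ i * s * ψ i) = s * s := by rw [hss, ← h]; group
    have h3 := mul_left_cancel h2
    exact eq_mul_inv_of_mul_eq h3
  let f : DihedralGroup (Nat.card C) → G := fun x => match x with
    | .r i => ψ i
    | .sr i => s * ψ i
  have hmul : ∀ x y, f (x * y) = f x * f y := by
    rintro (i | i) (j | j)
    · simp [f, hadd]
    · simp only [f, DihedralGroup.r_mul_sr]
      rw [← mul_assoc, hrel, mul_assoc, ← hadd]; congr 2; ring
    · simp [f, hadd, mul_assoc]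
    · simp only [f, DihedralGroup.sr_mul_sr]
      rw [mul_assoc, ← mul_assoc (ψ i), hrel, mul_assoc, ← mul_assoc, hss, one_mul, ← hadd]
      congr 1; ring
  have hfi : Function.Injective f := by
    rintro (i | i) (j | j) h
    · exact congrArg _ (hinj h)
    · exact absurd (show s * ψ j ∈ C from (show ψ i = s * ψ j from h) ▸ hψC i) (hnot j)
    · exact absurd (show s * ψ i ∈ C from (show s * ψ i = ψ j from h) ▸ hψC j) (hnot i)
    · exact congrArg _ (hinj (mul_left_cancel h))
  have hb : Function.Bijective f := by
    rw [Nat.bijective_iff_injective_and_card]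
    exact ⟨hfi, by rw [DihedralGroup.nat_card, ← hcard, mul_comm]⟩
  exact ⟨(MulEquiv.ofBijective (MonoidHom.mk' f hmul) hb).symm⟩

/-- embedding into `Perm` of index two gives alternating group -/
theorem alt_of_injective {G : Type*} [Group G] {n : ℕ} [Nontrivial (Fin n)] (f : G →* Equiv.Perm (Fin n))
    (hf : Function.Injective f) (hc : 2 * Nat.card G = n.factorial) :
    Nonempty (G ≃* alternatingGroup (Fin n)) := by
  have e := MonoidHom.ofInjective hf
  have h1 : Nat.card f.range = Nat.card G := (Nat.card_congr e.toEquiv).symm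
  have h2 := f.range.card_mul_index
  rw [h1, Nat.card_eq_fintype_card (α := Equiv.Perm (Fin n)), Fintype.card_perm, Fintype.card_fin,
    ← hc, mul_comm] at h2
  have hpos : 0 < Nat.card G := by
    have := n.factorial_pos; omega
  have h3 : f.range.index = 2 := Nat.eq_of_mul_eq_mul_right hpos h2
  have h4 := Equiv.Perm.eq_alternatingGroup_of_index_eq_two h3
  rw [h4] at e
  exact ⟨e⟩

theorem perm_of_injective {G : Type*} [Group G] {n : ℕ} (f : G →* Equiv.Perm (Fin n))
    (hf : Function.Injective f) (hc : Nat.card G = n.factorial) :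
    Nonempty (G ≃* Equiv.Perm (Fin n)) := by
  refine ⟨MulEquiv.ofBijective f ?_⟩
  rw [Nat.bijective_iff_injective_and_card]
  refine ⟨hf, ?_⟩
  rw [hc, Nat.card_eq_fintype_card (α := Equiv.Perm (Fin n)), Fintype.card_perm, Fintype.card_fin]

/-- permutation representation on Sylow subgroups, as permutations of `Fin n` -/
theorem exists_sylow_hom {G : Type*} [Group G] [Finite G] (p : ℕ) [Fact p.Prime] {n : ℕ}
    (hn : Nat.card (Sylow p G) = n) :
    ∃ f : G →* Equiv.Perm (Fin n), ∀ g, f g = 1 → ∀ P : Sylow p G, g • P = P := by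
  subst hn
  let e := Finite.equivFin (Sylow p G)
  refine ⟨(e.permCongrHom.toMonoidHom).comp (MulAction.toPermHom G (Sylow p G)), ?_⟩
  intro g hg P
  have : MulAction.toPermHom G (Sylow p G) g = 1 := by
    apply e.permCongrHom.injective
    rw [map_one]; exact hg
  have := DFunLike.congr_fun this P
  simpa using this

/-- The kernel meets p-elements trivially -/
theorem ker_le_sylow {G : Type*} [Group G] [Finite G] (p : ℕ) [Fact p.Prime]
    (K : Subgroup G) (hK : ∀ g ∈ K, ∀ P : Sylow p G, g • P = P) (H : Subgroup G) (hH : IsPGroup p H)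
    (hHK : H ≤ K) (P : Sylow p G) : H ≤ P := by
  rw [← hH.sylow_mem_fixedPoints_iff]
  rintro ⟨g, hg⟩
  exact hK g (hHK hg) P

theorem ker_le_normalizer {G : Type*} [Group G] [Finite G] (p : ℕ) [Fact p.Prime]
    (K : Subgroup G) (hK : ∀ g ∈ K, ∀ P : Sylow p G, g • P = P) (P : Sylow p G) :
    K ≤ Subgroup.normalizer (P : Set G) := by
  intro g hg
  have := hK g hg P
  rwa [Sylow.smul_eq_iff_mem_normalizer] at this

theorem coprime_of_no_pgroup {G : Type*} [Group G] [Finite G] (p : ℕ) [hp : Fact p.Prime]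
    (K : Subgroup G) (h : ∀ H : Subgroup G, IsPGroup p H → H ≤ K → H = ⊥) : ¬ p ∣ Nat.card K := by
  intro hd
  obtain ⟨x, hx⟩ := exists_prime_orderOf_dvd_card' p hd
  have hx' : orderOf (x : G) = p := by rw [← hx]; exact Subgroup.orderOf_coe x
  have h1 : Subgroup.zpowers (x : G) = ⊥ := by
    apply h
    · apply IsPGroup.of_card (n := 1)
      rw [Nat.card_zpowers, hx', pow_one]
    · simp
  have : (x : G) = 1 := by simpa using h1
  rw [this, orderOf_one] at hx'
  exact hp.1.one_lt.ne hx'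

theorem sylow3_case {G : Type*} [Group G] [Finite G] (hc : Nat.card G = 12 ∨ Nat.card G = 24)
    (hL : ∀ N : Subgroup G, N.Normal → IsCyclic N → N = ⊥) :
    ∃ f : G →* Equiv.Perm (Fin 4), Function.Injective f := by
  have : Fact (Nat.Prime 3) := ⟨Nat.prime_three⟩
  have hP3 : ∀ P : Sylow 3 G, Nat.card P = 3 := by
    intro P
    rw [P.card_eq_multiplicity]
    rcases hc with h | h <;> rw [h]
    · rw [show 12 = 3 ^ 1 * 4 by norm_num, Nat.factorization_mul (by norm_num) (by norm_num)]
      simp [Nat.prime_three.factorization, Nat.factorization_eq_zero_of_not_dvd (show ¬ 3 ∣ 4 by norm_num)]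
    · rw [show 24 = 3 ^ 1 * 8 by norm_num, Nat.factorization_mul (by norm_num) (by norm_num)]
      simp [Nat.prime_three.factorization, Nat.factorization_eq_zero_of_not_dvd (show ¬ 3 ∣ 8 by norm_num)]
  have hcyc : ∀ P : Sylow 3 G, IsCyclic P := fun P => isCyclic_of_prime_card (p := 3) (hP3 P)
  have hne : ∀ P : Sylow 3 G, (P : Subgroup G) ≠ ⊥ := by
    intro P h
    have := hP3 P
    rw [show Nat.card P = Nat.card (P : Subgroup G) from rfl, h] at this
    simp at this
  have hmod := card_sylow_modEq_one 3 G
  obtain ⟨P⟩ : Nonempty (Sylow 3 G) := inferInstance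
  have hidx : (P : Subgroup G).index = 4 ∨ (P : Subgroup G).index = 8 := by
    have := (P : Subgroup G).card_mul_index
    have h3 : Nat.card (P : Subgroup G) = 3 := hP3 P
    rw [h3] at this
    omega
  have hdvd := P.card_dvd_index
  have hne1 : Nat.card (Sylow 3 G) ≠ 1 := by
    intro h
    have : Subsingleton (Sylow 3 G) := (Nat.card_eq_one_iff_unique.1 h).1
    exact hne P (hL _ (P.normal_of_subsingleton) (hcyc P))
  have hd8 : Nat.card (Sylow 3 G) ∣ 8 := by
    rcases hidx with h | h <;> rw [h] at hdvd
    · exact hdvd.trans (by norm_num)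
    · exact hdvd
  have h4 : Nat.card (Sylow 3 G) = 4 := by
    have hle := Nat.le_of_dvd (by norm_num) hd8
    generalize Nat.card (Sylow 3 G) = m at *
    unfold Nat.ModEq at hmod
    interval_cases m <;> simp_all
  obtain ⟨f, hf⟩ := exists_sylow_hom 3 h4
  refine ⟨f, ?_⟩
  rw [← MonoidHom.ker_eq_bot_iff]
  have hK : ∀ g ∈ f.ker, ∀ P : Sylow 3 G, g • P = P := fun g hg => hf g hg
  have hN : Nat.card (Subgroup.normalizer (P : Set G)) ∣ 6 := by
    have h1 := (Subgroup.normalizer (P : Set G)).card_mul_index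
    rw [← P.card_eq_index_normalizer, h4] at h1
    rcases hc with h | h
    · have : Nat.card (Subgroup.normalizer (P : Set G)) = 3 := by omega
      rw [this]; norm_num
    · have : Nat.card (Subgroup.normalizer (P : Set G)) = 6 := by omega
      rw [this]
  have hK6 : Nat.card f.ker ∣ 6 := (Subgroup.card_dvd_of_le (ker_le_normalizer 3 _ hK P)).trans hN
  have hK3 : ¬ 3 ∣ Nat.card f.ker := by
    apply coprime_of_no_pgroup
    intro H hH hHK
    by_contra hbot
    apply hne1
    have hHP : ∀ P : Sylow 3 G, H = P := by
      intro P
      have hle := ker_le_sylow 3 _ hK H hH hHK P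
      have hd := Subgroup.card_dvd_of_le hle
      have h3 : Nat.card (P : Subgroup G) = 3 := hP3 P
      rw [h3, Nat.dvd_prime Nat.prime_three] at hd
      rcases hd with hd | hd
      · exact absurd (Subgroup.card_eq_one.1 hd) hbot
      · exact Subgroup.eq_of_le_of_card_ge hle (by rw [h3, hd])
    rw [Nat.card_eq_one_iff_unique]
    exact ⟨⟨fun P Q => Sylow.ext ((hHP P).symm.trans (hHP Q))⟩, ⟨P⟩⟩
  have hKle := Nat.le_of_dvd (by norm_num) hK6
  apply hL _ inferInstance
  have : Nat.card f.ker = 1 ∨ Nat.card f.ker = 2 := by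
    generalize Nat.card f.ker = m at *
    interval_cases m <;> simp_all
  rcases this with h | h
  · have := (Nat.card_eq_one_iff_unique.1 h).1
    infer_instance
  · have : Fact (Nat.Prime 2) := ⟨Nat.prime_two⟩
    exact isCyclic_of_prime_card h

theorem sylow2_case {G : Type*} [Group G] [Finite G] (hc : Nat.card G = 60)
    (hL : ∀ N : Subgroup G, N.Normal → IsCyclic N → N = ⊥)
    (hcent : ∀ t : G, orderOf t = 2 → Nat.card (Subgroup.centralizer {t}) ≤ 4)
    (hinv : Nat.card {t : G // orderOf t = 2} ≤ 30)
    (h4 : ∀ g : G, orderOf g ≠ 4) :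
    ∃ f : G →* Equiv.Perm (Fin 5), Function.Injective f := by
  have : Fact (Nat.Prime 2) := ⟨Nat.prime_two⟩
  have : Fact (Nat.Prime 3) := ⟨Nat.prime_three⟩
  have hP4 : ∀ P : Sylow 2 G, Nat.card (P : Subgroup G) = 4 := by
    intro P
    rw [show Nat.card (P : Subgroup G) = Nat.card P from rfl, P.card_eq_multiplicity, hc]
    rw [show 60 = 2 ^ 2 * 15 by norm_num, Nat.factorization_mul (by norm_num) (by norm_num)]
    rw [Nat.factorization_pow]
    simp [Nat.prime_two.factorization, Nat.factorization_eq_zero_of_not_dvd (show ¬ 2 ∣ 15 by norm_num)]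
  have hord : ∀ P : Sylow 2 G, ∀ x ∈ P, x ≠ 1 → orderOf x = 2 := by
    intro P x hx hx1
    have hd : orderOf x ∣ 4 := by
      rw [← hP4 P]
      exact Subgroup.orderOf_dvd_natCard _ hx
    have h1 : orderOf x ≠ 1 := by rwa [Ne, orderOf_eq_one_iff]
    have h4 := h4 x
    have hle := Nat.le_of_dvd (by norm_num) hd
    generalize orderOf x = m at *
    interval_cases m <;> simp_all
  have hPC : ∀ P : Sylow 2 G, ∀ t ∈ P, orderOf t = 2 →
      (P : Subgroup G) = Subgroup.centralizer {t} := by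
    intro P t ht ht2
    apply Subgroup.eq_of_le_of_card_ge
    · intro x hx
      rw [Subgroup.mem_centralizer_singleton_iff]
      have hcomm := IsPGroup.isMulCommutative_of_card_eq_prime_sq (p := 2) (G := (P : Subgroup G))
        (by rw [hP4 P]; norm_num)
      have := hcomm.is_comm.comm (⟨x, hx⟩ : (P : Subgroup G)) ⟨t, ht⟩
      exact congrArg Subtype.val this
    · rw [hP4]; exact hcent t ht2
  have hex : ∀ t : G, orderOf t = 2 → ∃ P : Sylow 2 G, t ∈ P := by
    intro t ht
    have : IsPGroup 2 (Subgroup.zpowers t) := by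
      apply IsPGroup.of_card (n := 1)
      rw [Nat.card_zpowers, ht, pow_one]
    obtain ⟨Q, hQ⟩ := this.exists_le_sylow
    exact ⟨Q, hQ (Subgroup.mem_zpowers t)⟩
  have huniq : ∀ P Q : Sylow 2 G, ∀ t ∈ P, t ∈ Q → t ≠ 1 → P = Q := by
    intro P Q t hP hQ ht
    have h2 := hord P t hP ht
    exact Sylow.ext ((hPC P t hP h2).trans (hPC Q t hQ h2).symm)
  have hcount : Nat.card {t : G // orderOf t = 2} = 3 * Nat.card (Sylow 2 G) := by
    let F : (Σ P : Sylow 2 G, {x : (P : Subgroup G) // x ≠ 1}) → {t : G // orderOf t = 2} :=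
      fun y => ⟨y.2.1.1, hord y.1 _ y.2.1.2 (by
        intro h; exact y.2.2 (Subtype.ext h))⟩
    have hF : Function.Bijective F := by
      constructor
      · rintro ⟨P, ⟨x, hx⟩, hx1⟩ ⟨Q, ⟨y, hy⟩, hy1⟩ h
        have hxy : x = y := congrArg Subtype.val h
        subst hxy
        have := huniq P Q x hx hy (by intro h; exact hx1 (Subtype.ext h))
        subst this
        rfl
      · rintro ⟨t, ht⟩
        obtain ⟨P, hP⟩ := hex t ht
        refine ⟨⟨P, ⟨t, hP⟩, ?_⟩, rfl⟩
        intro h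
        have : t = 1 := congrArg Subtype.val h
        rw [this, orderOf_one] at ht
        omega
    have := Fintype.ofFinite (Sylow 2 G)
    rw [← Nat.card_eq_of_bijective F hF, Nat.card_sigma]
    have : ∀ P : Sylow 2 G, Nat.card {x : (P : Subgroup G) // x ≠ 1} = 3 := by
      intro P
      have := hP4 P
      classical
      have := Fintype.ofFinite (P : Subgroup G)
      rw [Nat.card_eq_fintype_card, Fintype.card_subtype_compl, Fintype.card_subtype_eq,
        ← Nat.card_eq_fintype_card, hP4]
    simp only [this]
    simp [mul_comm, Nat.card_eq_fintype_card]
  obtain ⟨t, ht⟩ : ∃ t : G, orderOf t = 2 :=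
    exists_prime_orderOf_dvd_card' 2 (by rw [hc]; norm_num)
  have hlow : 15 ≤ Nat.card {t : G // orderOf t = 2} := by
    have h1 := (Subgroup.centralizer {t}).card_mul_index
    have h2 := hcent t ht
    rw [hc] at h1
    have h3 : 15 ≤ (Subgroup.centralizer {t}).index := by
      by_contra! h
      nlinarith
    refine h3.trans ?_
    apply Nat.card_le_card_of_injective
      (fun q : G ⧸ Subgroup.centralizer {t} => (⟨q.out * t * q.out⁻¹, by
        rw [← ht]; exact orderOf_injective (MulAut.conj q.out).toMonoidHom (MulAut.conj q.out).injective t⟩ : {t : G // orderOf t = 2}))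
    intro q q' h
    have h' : q.out * t * q.out⁻¹ = q'.out * t * q'.out⁻¹ := congrArg Subtype.val h
    rw [← q.out_eq', ← q'.out_eq', QuotientGroup.eq, Subgroup.mem_centralizer_singleton_iff]
    have : q.out⁻¹ * (q.out * t * q.out⁻¹) * q'.out = q.out⁻¹ * (q'.out * t * q'.out⁻¹) * q'.out := by rw [h']
    simpa [mul_assoc] using this.symm
  obtain ⟨P⟩ : Nonempty (Sylow 2 G) := inferInstance
  have hn5 : Nat.card (Sylow 2 G) = 5 := by
    have hd := P.card_dvd_index
    have hi := (P : Subgroup G).card_mul_index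
    rw [hP4, hc] at hi
    have : (P : Subgroup G).index = 15 := by omega
    rw [this] at hd
    rw [hcount] at hlow hinv
    generalize Nat.card (Sylow 2 G) = m at *
    have : m ≤ 10 := by omega
    have : 5 ≤ m := by omega
    interval_cases m <;> simp_all
  obtain ⟨f, hf⟩ := exists_sylow_hom 2 hn5
  refine ⟨f, ?_⟩
  rw [← MonoidHom.ker_eq_bot_iff]
  have hK : ∀ g ∈ f.ker, ∀ P : Sylow 2 G, g • P = P := fun g hg => hf g hg
  have hN : Nat.card (Subgroup.normalizer (P : Set G)) = 12 := by
    have h1 := (Subgroup.normalizer (P : Set G)).card_mul_index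
    rw [← P.card_eq_index_normalizer, hn5] at h1
    omega
  have hK12 : Nat.card f.ker ∣ 12 := by
    rw [← hN]; exact Subgroup.card_dvd_of_le (ker_le_normalizer 2 _ hK P)
  have hK2 : ¬ 2 ∣ Nat.card f.ker := by
    apply coprime_of_no_pgroup
    intro H hH hHK
    by_contra hbot
    obtain ⟨x, hxH, hx1⟩ := H.bot_or_exists_ne_one.resolve_left hbot
    have hall : ∀ P Q : Sylow 2 G, P = Q := fun P Q =>
      huniq P Q x (ker_le_sylow 2 _ hK H hH hHK P hxH) (ker_le_sylow 2 _ hK H hH hHK Q hxH) hx1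
    have : Nat.card (Sylow 2 G) = 1 := by
      rw [Nat.card_eq_one_iff_unique]
      exact ⟨⟨hall⟩, ⟨P⟩⟩
    omega
  apply hL _ inferInstance
  have hKle := Nat.le_of_dvd (by norm_num) hK12
  have : Nat.card f.ker = 1 ∨ Nat.card f.ker = 3 := by
    generalize Nat.card f.ker = m at *
    interval_cases m <;> simp_all
  rcases this with h | h
  · have := (Nat.card_eq_one_iff_unique.1 h).1
    infer_instance
  · exact isCyclic_of_prime_card h

open MulAction in
theorem eq_one_of_three {G X : Type*} [Group G] [MulAction G X]
    (hA : ∀ g : G, g ≠ 1 → ∃ p q : X, p ≠ q ∧ ∀ x, g • x = x ↔ x = p ∨ x = q)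
    (g : G) (a b c : X) (hab : a ≠ b) (hac : a ≠ c) (hbc : b ≠ c)
    (ha : g • a = a) (hb : g • b = b) (hc : g • c = c) : g = 1 := by
  by_contra h
  obtain ⟨p, q, hpq, hx⟩ := hA g h
  rw [hx] at ha hb hc
  grind

open MulAction in
theorem orbit_one_case {G X : Type*} [Group G] [MulAction G X]
    (hB : ∀ x : X, IsCyclic (stabilizer G x)) (p : X) (hp : Nat.card (orbit G p) = 1) :
    IsCyclic G := by
  have h := index_stabilizer G p
  rw [← Nat.card_coe_set_eq, hp, Subgroup.index_eq_one] at h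
  have h2 := hB p
  rw [h] at h2
  exact isCyclic_of_surjective (Subgroup.topEquiv : (⊤ : Subgroup G) ≃* G) (MulEquiv.surjective _)

open MulAction in
theorem orbit_two_case {G X : Type*} [Group G] [Finite G] [MulAction G X]
    (hA : ∀ g : G, g ≠ 1 → ∃ p q : X, p ≠ q ∧ ∀ x, g • x = x ↔ x = p ∨ x = q)
    (hB : ∀ x : X, IsCyclic (stabilizer G x)) (p : X) (hp : Nat.card (orbit G p) = 2) :
    Nonempty (G ≃* DihedralGroup (Nat.card (stabilizer G p))) := by
  have h := index_stabilizer G p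
  rw [← Nat.card_coe_set_eq, hp] at h
  apply dihedral_of_index_two _ (hB p) h
  intro g hg
  have h2 : g * g ∈ stabilizer G p := Subgroup.mul_self_mem_of_index_two h g
  rw [mem_stabilizer_iff] at hg h2
  have hg1 : g ≠ 1 := by rintro rfl; simp at hg
  obtain ⟨x, y, -, hxy⟩ := hA g hg1
  have hx : g • x = x := (hxy x).2 (Or.inl rfl)
  apply eq_one_of_three hA (g * g) p (g • p) x
  · exact fun h => hg h.symm
  · rintro rfl; exact hg hx
  · rintro rfl
    exact hg (MulAction.injective g hx)
  · exact h2
  · rw [← mul_smul, mul_assoc, mul_smul, h2]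
  · rw [mul_smul, hx, hx]

open MulAction in
theorem no_normal_cyclic {G X : Type*} [Group G] [Finite G] [MulAction G X]
    (hA : ∀ g : G, g ≠ 1 → ∃ p q : X, p ≠ q ∧ ∀ x, g • x = x ↔ x = p ∨ x = q)
    (h3 : ∀ x : X, 3 ≤ Nat.card (orbit G x)) (N : Subgroup G) (hN : N.Normal) (hc : IsCyclic N) :
    N = ⊥ := by
  obtain ⟨⟨n, hn⟩, hgen⟩ := hc.exists_generator
  by_contra hbot
  have hgen' : ∀ m ∈ N, ∃ k : ℤ, n ^ k = m := by
    intro m hm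
    obtain ⟨k, hk⟩ := hgen ⟨m, hm⟩
    exact ⟨k, congrArg Subtype.val hk⟩
  have hn1 : n ≠ 1 := by
    rintro rfl
    apply hbot
    rw [Subgroup.eq_bot_iff_forall]
    intro m hm
    obtain ⟨k, hk⟩ := hgen' m hm
    simpa using hk.symm
  obtain ⟨p, q, hpq, hx⟩ := hA n hn1
  have hnp : n ∈ stabilizer G p := (hx p).2 (Or.inl rfl)
  have hNp : ∀ m ∈ N, m • p = p := by
    intro m hm
    obtain ⟨k, rfl⟩ := hgen' m hm
    exact (stabilizer G p).zpow_mem hnp k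
  have hsub : orbit G p ⊆ {p, q} := by
    rintro _ ⟨h, rfl⟩
    change h • p ∈ _
    have : n • h • p = h • p := by
      have := hNp (h⁻¹ * n * h) (by simpa using hN.conj_mem n hn h⁻¹)
      rw [mul_smul, mul_smul, inv_smul_eq_iff] at this
      exact this
    simpa using (hx _).1 this
  have := Set.ncard_le_ncard hsub (by simp)
  rw [Set.ncard_pair hpq, ← Nat.card_coe_set_eq] at this
  have := h3 p
  omega

theorem arith_ordered (n e0 e1 e2 s0 s1 s2 : ℕ) (h0 : s0 * e0 = n) (h1 : s1 * e1 = n)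
    (h2 : s2 * e2 = n) (hs : s0 + s1 + s2 = n + 2) (_hs0 : 3 ≤ s0) (_hs1 : 3 ≤ s1) (hs2 : 3 ≤ s2)
    (he0 : 2 ≤ e0) (h01 : e0 ≤ e1) (h12 : e1 ≤ e2) :
    e0 = 2 ∧ e1 = 3 ∧ (n = 12 ∨ n = 24 ∨ (n = 60 ∧ e2 = 5)) := by
  have a : e0 = 2 := by
    by_contra h
    have : 3 ≤ e0 := by omega
    have : s0 * 3 ≤ n := h0 ▸ Nat.mul_le_mul_left _ this
    have : s1 * 3 ≤ n := h1 ▸ Nat.mul_le_mul_left _ (by omega)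
    have : s2 * 3 ≤ n := h2 ▸ Nat.mul_le_mul_left _ (by omega)
    omega
  subst a
  have b : e1 = 3 := by
    by_contra h
    rcases (by omega : e1 = 2 ∨ 4 ≤ e1) with h | h
    · subst h; omega
    · have : s1 * 4 ≤ n := h1 ▸ Nat.mul_le_mul_left _ (by omega)
      have : s2 * 4 ≤ n := h2 ▸ Nat.mul_le_mul_left _ (by omega)
      omega
  subst b
  refine ⟨rfl, rfl, ?_⟩
  have : e2 < 6 := by
    by_contra h
    have : s2 * 6 ≤ n := h2 ▸ Nat.mul_le_mul_left _ (by omega)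
    omega
  interval_cases e2 <;> omega

theorem arith_case (n e0 e1 e2 s0 s1 s2 : ℕ) (h0 : s0 * e0 = n) (h1 : s1 * e1 = n)
    (h2 : s2 * e2 = n) (hs : s0 + s1 + s2 = n + 2) (hs0 : 3 ≤ s0) (hs1 : 3 ≤ s1) (hs2 : 3 ≤ s2)
    (he0 : 2 ≤ e0) (he1 : 2 ≤ e1) (he2 : 2 ≤ e2) :
    n = 12 ∨ n = 24 ∨ (n = 60 ∧ 
      ((e0 = 2 ∧ e1 = 3 ∧ e2 = 5) ∨ (e0 = 2 ∧ e1 = 5 ∧ e2 = 3) ∨ (e0 = 3 ∧ e1 = 2 ∧ e2 = 5) ∨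
       (e0 = 3 ∧ e1 = 5 ∧ e2 = 2) ∨ (e0 = 5 ∧ e1 = 2 ∧ e2 = 3) ∨ (e0 = 5 ∧ e1 = 3 ∧ e2 = 2))) := by
  rcases le_total e0 e1 with a | a <;> rcases le_total e1 e2 with b | b <;>
    rcases le_total e0 e2 with c | c
  · obtain ⟨r0, r1, r | r | ⟨r, r2⟩⟩ := arith_ordered n e0 e1 e2 s0 s1 s2 h0 h1 h2 (by omega) hs0 hs1 hs2 he0 a b
    · exact Or.inl r
    · exact Or.inr (Or.inl r)
    · exact Or.inr (Or.inr ⟨r, by simp [r0, r1, r2]⟩)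
  · obtain ⟨r0, r1, r | r | ⟨r, r2⟩⟩ := arith_ordered n e0 e1 e2 s0 s1 s2 h0 h1 h2 (by omega) hs0 hs1 hs2 he0 a b
    · exact Or.inl r
    · exact Or.inr (Or.inl r)
    · exact Or.inr (Or.inr ⟨r, by simp [r0, r1, r2]⟩)
  · obtain ⟨r0, r1, r | r | ⟨r, r2⟩⟩ := arith_ordered n e0 e2 e1 s0 s2 s1 h0 h2 h1 (by omega) hs0 hs2 hs1 he0 c b
    · exact Or.inl r
    · exact Or.inr (Or.inl r)
    · exact Or.inr (Or.inr ⟨r, by simp [r0, r1, r2]⟩)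
  · obtain ⟨r0, r1, r | r | ⟨r, r2⟩⟩ := arith_ordered n e2 e0 e1 s2 s0 s1 h2 h0 h1 (by omega) hs2 hs0 hs1 he2 c a
    · exact Or.inl r
    · exact Or.inr (Or.inl r)
    · exact Or.inr (Or.inr ⟨r, by simp [r0, r1, r2]⟩)
  · obtain ⟨r0, r1, r | r | ⟨r, r2⟩⟩ := arith_ordered n e1 e0 e2 s1 s0 s2 h1 h0 h2 (by omega) hs1 hs0 hs2 he1 a c
    · exact Or.inl r
    · exact Or.inr (Or.inl r)
    · exact Or.inr (Or.inr ⟨r, by simp [r0, r1, r2]⟩)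
  · obtain ⟨r0, r1, r | r | ⟨r, r2⟩⟩ := arith_ordered n e1 e2 e0 s1 s2 s0 h1 h2 h0 (by omega) hs1 hs2 hs0 he1 b c
    · exact Or.inl r
    · exact Or.inr (Or.inl r)
    · exact Or.inr (Or.inr ⟨r, by simp [r0, r1, r2]⟩)
  · obtain ⟨r0, r1, r | r | ⟨r, r2⟩⟩ := arith_ordered n e2 e1 e0 s2 s1 s0 h2 h1 h0 (by omega) hs2 hs1 hs0 he2 b a
    · exact Or.inl r
    · exact Or.inr (Or.inl r)
    · exact Or.inr (Or.inr ⟨r, by simp [r0, r1, r2]⟩)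
  · obtain ⟨r0, r1, r | r | ⟨r, r2⟩⟩ := arith_ordered n e2 e1 e0 s2 s1 s0 h2 h1 h0 (by omega) hs2 hs1 hs0 he2 b a
    · exact Or.inl r
    · exact Or.inr (Or.inl r)
    · exact Or.inr (Or.inr ⟨r, by simp [r0, r1, r2]⟩)

open MulAction in
theorem icosahedral_case {G X : Type*} [Group G] [Finite G] [MulAction G X]
    (hA : ∀ g : G, g ≠ 1 → ∃ p q : X, p ≠ q ∧ ∀ x, g • x = x ↔ x = p ∨ x = q)
    (h3 : ∀ x : X, 3 ≤ Nat.card (orbit G x))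
    (hc : Nat.card G = 60) (x0 : X)
    (hst : ∀ x : X, Nat.card (stabilizer G x) = 2 ∨ Nat.card (stabilizer G x) = 3 ∨
      Nat.card (stabilizer G x) = 5)
    (hx0 : Nat.card (stabilizer G x0) = 2)
    (huniq : ∀ x : X, Nat.card (stabilizer G x) = 2 → x ∈ orbit G x0) :
    ∃ f : G →* Equiv.Perm (Fin 5), Function.Injective f := by
  have hfix : ∀ t : G, orderOf t = 2 → t ≠ 1 := by
    rintro t ht rfl
    simp at ht
  have heven : ∀ t : G, orderOf t = 2 → ∀ x : X, t • x = x → Nat.card (stabilizer G x) = 2 := by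
    intro t ht x hx
    have : orderOf t ∣ Nat.card (stabilizer G x) := Subgroup.orderOf_dvd_natCard _ hx
    rw [ht] at this
    have := hst x
    omega
  apply sylow2_case hc (no_normal_cyclic hA h3)
  · intro t ht
    obtain ⟨p, q, hpq, hx⟩ := hA t (hfix t ht)
    have hp : t • p = p := (hx p).2 (Or.inl rfl)
    let C := Subgroup.centralizer {t}
    have h1 : Nat.card (orbit C p) * Nat.card (stabilizer C p) = Nat.card C := by
      rw [← Nat.card_prod]
      exact Nat.card_congr (orbitProdStabilizerEquivGroup C p)
    have h2 : Nat.card (orbit C p) ≤ 2 := by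
      have hsub : orbit C p ⊆ {p, q} := by
        rintro _ ⟨⟨h, hh⟩, rfl⟩
        change h • p ∈ _
        have : t • h • p = h • p := by
          rw [← mul_smul, ← Subgroup.mem_centralizer_singleton_iff.1 hh, mul_smul, hp]
        simpa using (hx _).1 this
      have := Set.ncard_le_ncard hsub (by simp)
      rwa [Set.ncard_pair hpq, ← Nat.card_coe_set_eq] at this
    have h3 : Nat.card (stabilizer C p) ≤ 2 := by
      rw [← heven t ht p hp]
      apply Nat.card_le_card_of_injective
        (fun c : stabilizer C p => (⟨c.1.1, c.2⟩ : stabilizer G p))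
      intro a b hab
      have : (a.1.1 : G) = b.1.1 := Subtype.mk.inj hab
      exact Subtype.ext (Subtype.ext this)
    change Nat.card C ≤ 4
    rw [← h1]
    exact Nat.mul_le_mul h2 h3
  · have h1 : Nat.card (orbit G x0) * Nat.card (stabilizer G x0) = Nat.card G := by
      rw [← Nat.card_prod]
      exact Nat.card_congr (orbitProdStabilizerEquivGroup G x0)
    have h30 : Nat.card (orbit G x0) = 30 := by rw [hx0, hc] at h1; omega
    rw [← h30]
    have hex : ∀ t : {t : G // orderOf t = 2}, ∃ p : X, t.1 • p = p := by
      rintro ⟨t, ht⟩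
      obtain ⟨p, q, hpq, hx⟩ := hA t (hfix t ht)
      exact ⟨p, (hx p).2 (Or.inl rfl)⟩
    choose P hP using hex
    have : Finite (orbit G x0) := Nat.finite_of_card_ne_zero (by omega)
    apply Nat.card_le_card_of_injective
      (fun t => (⟨P t, huniq _ (heven t.1 t.2 _ (hP t))⟩ : orbit G x0))
    intro t u htu
    have hPe : P t = P u := congrArg Subtype.val htu
    have h2 := heven t.1 t.2 _ (hP t)
    have hu := hP u
    rw [← hPe] at hu
    rw [Nat.card_eq_two_iff' (1 : stabilizer G (P t))] at h2
    obtain ⟨y, -, hy⟩ := h2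
    have e1 := hy ⟨t.1, hP t⟩ (fun h => hfix t.1 t.2 (congrArg Subtype.val h))
    have e2 := hy ⟨u.1, hu⟩ (fun h => hfix u.1 u.2 (congrArg Subtype.val h))
    have e3 : t.1 = u.1 := Subtype.mk.inj (e1.trans e2.symm)
    exact Subtype.ext e3
  · intro g hg
    have hg1 : g ≠ 1 := by rintro rfl; simp at hg
    obtain ⟨p, q, hpq, hx⟩ := hA g hg1
    have : orderOf g ∣ Nat.card (stabilizer G p) :=
      Subgroup.orderOf_dvd_natCard _ ((hx p).2 (Or.inl rfl))
    rw [hg] at this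
    have := hst p
    omega

open MulAction in
theorem burnside_count {G X : Type*} [Group G] [Finite G] [Finite X] [MulAction G X]
    (hA : ∀ g : G, g ≠ 1 → ∃ p q : X, p ≠ q ∧ ∀ x, g • x = x ↔ x = p ∨ x = q) :
    2 * Nat.card G + Nat.card X = Nat.card (orbitRel.Quotient G X) * Nat.card G + 2 := by
  classical
  have := Fintype.ofFinite G
  have := Fintype.ofFinite X
  have := Fintype.ofFinite (orbitRel.Quotient G X)
  have h := sum_card_fixedBy_eq_card_orbits_mul_card_group G X
  have h1 : Fintype.card (fixedBy X (1 : G)) = Fintype.card X := by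
    simp
  have h2 : ∀ g ∈ (Finset.univ : Finset G).erase 1, Fintype.card (fixedBy X g) = 2 := by
    intro g hg
    obtain ⟨p, q, hpq, hx⟩ := hA g (Finset.ne_of_mem_erase hg)
    have : fixedBy X g = {p, q} := by
      ext x; simp [hx]
    rw [← Nat.card_eq_fintype_card, Nat.card_coe_set_eq, this, Set.ncard_pair hpq]
  rw [← Finset.add_sum_erase _ _ (Finset.mem_univ (1 : G)), Finset.sum_congr rfl h2, h1] at h
  simp only [Finset.sum_const, Finset.card_erase_of_mem (Finset.mem_univ _), Finset.card_univ,
    smul_eq_mul] at h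
  simp only [Nat.card_eq_fintype_card]
  have : 0 < Fintype.card G := Fintype.card_pos
  rw [← h]
  omega

open MulAction in
theorem abstract_classification {G X : Type*} [Group G] [Finite G] [Finite X] [MulAction G X]
    (hA : ∀ g : G, g ≠ 1 → ∃ p q : X, p ≠ q ∧ ∀ x, g • x = x ↔ x = p ∨ x = q)
    (hB : ∀ x : X, IsCyclic (stabilizer G x))
    (hC : ∀ x : X, ∃ g : G, g ≠ 1 ∧ g • x = x) :
    Nonempty (G ≃* alternatingGroup (Fin 5)) ∨
    Nonempty (G ≃* Equiv.Perm (Fin 4)) ∨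
    Nonempty (G ≃* alternatingGroup (Fin 4)) ∨
    (∃ ν : ℕ, 2 ≤ ν ∧ Nonempty (G ≃* DihedralGroup ν)) ∨
    (∃ ν : ℕ, 1 ≤ ν ∧ Nonempty (G ≃* Multiplicative (ZMod ν))) := by
  have hcyc : IsCyclic G → ∃ ν : ℕ, 1 ≤ ν ∧ Nonempty (G ≃* Multiplicative (ZMod ν)) := fun h =>
    ⟨Nat.card G, Nat.card_pos, ⟨(zmodCyclicMulEquiv h).symm⟩⟩
  by_cases hn1 : Nat.card G = 1
  · right; right; right; right
    have := (Nat.card_eq_one_iff_unique.1 hn1).1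
    exact hcyc inferInstance
  have hnpos : 0 < Nat.card G := Nat.card_pos
  have hst2 : ∀ x : X, 2 ≤ Nat.card (stabilizer G x) := by
    intro x
    obtain ⟨g, hg, hgx⟩ := hC x
    have : Nontrivial (stabilizer G x) := ⟨⟨⟨g, hgx⟩, 1, fun h => hg (Subtype.ext_iff.1 h)⟩⟩
    exact Finite.one_lt_card
  by_cases h1 : ∃ p : X, Nat.card (orbit G p) = 1
  · right; right; right; right
    obtain ⟨p, hp⟩ := h1
    exact hcyc (orbit_one_case hB p hp)
  by_cases h2 : ∃ p : X, Nat.card (orbit G p) = 2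
  · right; right; right; left
    obtain ⟨p, hp⟩ := h2
    exact ⟨_, hst2 p, orbit_two_case hA hB p hp⟩
  push Not at h1 h2
  have hos : ∀ x : X, Nat.card (orbit G x) * Nat.card (stabilizer G x) = Nat.card G := by
    intro x
    rw [← Nat.card_prod]
    exact Nat.card_congr (orbitProdStabilizerEquivGroup G x)
  have h3 : ∀ x : X, 3 ≤ Nat.card (orbit G x) := by
    intro x
    have a := h1 x
    have b := h2 x
    have : Nonempty (orbit G x) := ⟨⟨x, mem_orbit_self x⟩⟩
    have c : 0 < Nat.card (orbit G x) := Nat.card_pos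
    omega
  have hL := no_normal_cyclic hA h3
  have hburn := burnside_count hA
  have := Fintype.ofFinite (orbitRel.Quotient G X)
  have hX : Nat.card X = ∑ ω : orbitRel.Quotient G X, Nat.card (orbit G ω.out) := by
    rw [Nat.card_congr (selfEquivSigmaOrbits G X), Nat.card_sigma]
  have hXle : 2 * Nat.card X ≤ Nat.card (orbitRel.Quotient G X) * Nat.card G := by
    rw [hX, Finset.mul_sum, Nat.card_eq_fintype_card, ← Finset.card_univ, ← smul_eq_mul,
      ← Finset.sum_const]
    apply Finset.sum_le_sum
    intro ω _
    rw [← hos ω.out, mul_comm]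
    exact Nat.mul_le_mul_left _ (hst2 _)
  have hXge : 3 * Nat.card (orbitRel.Quotient G X) ≤ Nat.card X := by
    rw [hX, Nat.card_eq_fintype_card (α := orbitRel.Quotient G X), ← Finset.card_univ, mul_comm,
      ← smul_eq_mul, ← Finset.sum_const]
    exact Finset.sum_le_sum fun ω _ => h3 _
  have hr : Nat.card (orbitRel.Quotient G X) = 3 := by
    generalize Nat.card (orbitRel.Quotient G X) = r at *
    have : r < 4 := by
      by_contra! h
      have : 4 * Nat.card G ≤ r * Nat.card G := Nat.mul_le_mul_right _ h
      omega
    interval_cases r <;> omega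
  rw [hr] at hburn
  rw [Nat.card_eq_fintype_card, ← Finset.card_univ, ] at hr
  classical
  obtain ⟨a, b, c, hab, hac, hbc, huniv⟩ := Finset.card_eq_three.1 hr
  have hall : ∀ ω : orbitRel.Quotient G X, ω = a ∨ ω = b ∨ ω = c := by
    intro ω
    have := Finset.mem_univ ω
    rw [huniv] at this
    simpa using this
  rw [huniv, Finset.sum_insert (by simp [hab, hac]), Finset.sum_insert (by simp [hbc]),
    Finset.sum_singleton] at hX
  have hrep : ∀ x : X, ∃ ω : orbitRel.Quotient G X, x ∈ orbit G ω.out ∧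
      Nat.card (stabilizer G x) = Nat.card (stabilizer G ω.out) := by
    intro x
    have hx : x ∈ orbit G (Quotient.mk'' x : orbitRel.Quotient G X).out := by
      rw [← orbitRel_apply]
      exact (orbitRel G X).symm (Quotient.mk_out (s := orbitRel G X) x)
    refine ⟨Quotient.mk'' x, hx, ?_⟩
    exact Nat.card_congr (stabilizerEquivStabilizerOfOrbitRel (orbitRel_apply.2 hx)).toEquiv
  rcases arith_case _ _ _ _ _ _ _ (hos a.out) (hos b.out) (hos c.out) (by omega) (h3 _) (h3 _)
    (h3 _) (hst2 _) (hst2 _) (hst2 _) with h | h | ⟨h, he⟩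
  · right; right; left
    obtain ⟨f, hf⟩ := sylow3_case (Or.inl h) hL
    exact alt_of_injective f hf (by rw [h]; rfl)
  · right; left
    obtain ⟨f, hf⟩ := sylow3_case (Or.inr h) hL
    exact perm_of_injective f hf (by rw [h]; rfl)
  · left
    have hω : ∀ ω : orbitRel.Quotient G X, Nat.card (stabilizer G ω.out) = 2 ∨
        Nat.card (stabilizer G ω.out) = 3 ∨ Nat.card (stabilizer G ω.out) = 5 := by
      intro ω
      rcases hall ω with rfl | rfl | rfl <;> omega
    obtain ⟨ω0, hω0, hu⟩ : ∃ ω0 : orbitRel.Quotient G X, Nat.card (stabilizer G ω0.out) = 2 ∧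
        ∀ ω : orbitRel.Quotient G X, Nat.card (stabilizer G ω.out) = 2 → ω = ω0 := by
      by_cases ha : Nat.card (stabilizer G a.out) = 2
      · refine ⟨a, ha, fun ω h2 => ?_⟩
        rcases hall ω with rfl | rfl | rfl
        · rfl
        · omega
        · omega
      · by_cases hb : Nat.card (stabilizer G b.out) = 2
        · refine ⟨b, hb, fun ω h2 => ?_⟩
          rcases hall ω with rfl | rfl | rfl
          · omega
          · rfl
          · omega
        · refine ⟨c, by omega, fun ω h2 => ?_⟩
          rcases hall ω with rfl | rfl | rfl
          · omega
          · omega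
          · rfl
    obtain ⟨f, hf⟩ := icosahedral_case hA h3 h ω0.out (fun x => by
      obtain ⟨ω, -, hx⟩ := hrep x
      rw [hx]; exact hω ω) hω0 (fun x hx => by
      obtain ⟨ω, hxω, hx'⟩ := hrep x
      rw [hx'] at hx
      rw [← hu ω hx]; exact hxω)
    exact alt_of_injective f hf (by rw [h]; rfl)

/-- The same without assuming that all points have nontrivial stabilizer or finiteness. -/
theorem abstract_classification' {G X : Type*} [Group G] [Finite G] [MulAction G X]
    (hA : ∀ g : G, g ≠ 1 → ∃ p q : X, p ≠ q ∧ ∀ x, g • x = x ↔ x = p ∨ x = q)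
    (hB : ∀ x : X, IsCyclic (MulAction.stabilizer G x)) :
    Nonempty (G ≃* alternatingGroup (Fin 5)) ∨
    Nonempty (G ≃* Equiv.Perm (Fin 4)) ∨
    Nonempty (G ≃* alternatingGroup (Fin 4)) ∨
    (∃ ν : ℕ, 2 ≤ ν ∧ Nonempty (G ≃* DihedralGroup ν)) ∨
    (∃ ν : ℕ, 1 ≤ ν ∧ Nonempty (G ≃* Multiplicative (ZMod ν))) := by
  let Y : SubMulAction G X :=
    { carrier := {x | ∃ g : G, g ≠ 1 ∧ g • x = x}
      smul_mem' := by
        rintro h x ⟨g, hg, hgx⟩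
        refine ⟨h * g * h⁻¹, ?_, ?_⟩
        · intro h'
          apply hg
          rwa [conj_eq_one_iff] at h'
        · rw [mul_smul, inv_smul_smul, mul_smul, hgx] }
  have hY : ∀ x : X, x ∈ Y ↔ ∃ g : G, g ≠ 1 ∧ g • x = x := fun x => Iff.rfl
  have hfin : Finite Y := by
    have : (⋃ g ∈ {g : G | g ≠ 1}, {x : X | g • x = x}).Finite := by
      apply Set.Finite.biUnion (Set.toFinite _)
      intro g hg
      obtain ⟨p, q, -, hx⟩ := hA g hg
      apply Set.Finite.subset (Set.toFinite {p, q})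
      intro x hx'
      simpa using (hx x).1 hx'
    apply Set.Finite.subset this
    rintro x ⟨g, hg, hgx⟩
    simp only [Set.mem_iUnion]
    exact ⟨g, hg, hgx⟩
  apply abstract_classification (X := Y)
  · intro g hg
    obtain ⟨p, q, hpq, hx⟩ := hA g hg
    refine ⟨⟨p, (hY p).2 ⟨g, hg, (hx p).2 (Or.inl rfl)⟩⟩, ⟨q, (hY q).2 ⟨g, hg, (hx q).2 (Or.inr rfl)⟩⟩,
      fun h => hpq (Subtype.ext_iff.1 h), ?_⟩
    rintro ⟨x, hxY⟩
    simp only [Subtype.ext_iff, SubMulAction.val_smul]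
    exact hx x
  · intro x
    rw [SubMulAction.stabilizer_of_subMul]
    exact hB x
  · rintro ⟨x, g, hg, hgx⟩
    exact ⟨g, hg, Subtype.ext hgx⟩

open Module in
theorem diag_or_scalar {k : Type*} [Field k] [IsAlgClosed k] [CharZero k]
    (g : Matrix (Fin 2) (Fin 2) k) (m : ℕ) (hm : m ≠ 0) (c : k) (hc : c ≠ 0)
    (h : g ^ m = c • (1 : Matrix (Fin 2) (Fin 2) k)) :
    (∃ a : k, g = Matrix.scalar (Fin 2) a) ∨
    ∃ (v w : Fin 2 → k) (μ ν : k), μ ≠ ν ∧ v ≠ 0 ∧ w ≠ 0 ∧ g *ᵥ v = μ • v ∧ g *ᵥ w = ν • w := by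
  have hss : Module.End.IsSemisimple (Matrix.toLinAlgEquiv' g) := by
    apply Module.End.isSemisimple_of_squarefree_aeval_eq_zero
      (p := Polynomial.X ^ m - Polynomial.C c)
    · exact (Polynomial.separable_X_pow_sub_C c (by exact_mod_cast hm) hc).squarefree
    · rw [map_sub, map_pow, Polynomial.aeval_X, Polynomial.aeval_C, ← map_pow, h, map_smul, map_one,
        Algebra.algebraMap_eq_smul_one, sub_self]
  have htop := hss.iSup_eigenspace_eq_top
  obtain ⟨μ, hμ⟩ := Module.End.exists_eigenvalue (Matrix.toLinAlgEquiv' g)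
  obtain ⟨v, hv⟩ := hμ.exists_hasEigenvector
  by_cases hex : ∃ ν, μ ≠ ν ∧ Module.End.HasEigenvalue (Matrix.toLinAlgEquiv' g) ν
  · right
    obtain ⟨ν, hne, hν⟩ := hex
    obtain ⟨w, hw⟩ := hν.exists_hasEigenvector
    exact ⟨v, w, μ, ν, hne, hv.2, hw.2, by simpa using hv.apply_eq_smul,
      by simpa using hw.apply_eq_smul⟩
  · left
    refine ⟨μ, ?_⟩
    have hT : End.eigenspace (Matrix.toLinAlgEquiv' g) μ = ⊤ := by
      rw [eq_top_iff, ← htop]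
      apply iSup_le
      intro ν
      by_cases hμν : μ = ν
      · rw [hμν]
      · have : ¬ Module.End.HasEigenvalue (Matrix.toLinAlgEquiv' g) ν := fun hν => hex ⟨ν, hμν, hν⟩
        rw [Module.End.hasEigenvalue_iff, not_not] at this
        rw [this]; exact bot_le
    have hall : ∀ x : Fin 2 → k, g *ᵥ x = μ • x := by
      intro x
      have : x ∈ End.eigenspace (Matrix.toLinAlgEquiv' g) μ := by rw [hT]; trivial
      simpa using Module.End.mem_eigenspace_iff.1 this
    apply Matrix.toLinAlgEquiv'.injective
    ext i
    simp [hall, Pi.single_apply]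

theorem eig_decomp {k : Type*} [Field k] (g : Matrix (Fin 2) (Fin 2) k)
    (v w : Fin 2 → k) (μ ν : k) (hne : μ ≠ ν) (hv : v ≠ 0) (hw : w ≠ 0)
    (hgv : g *ᵥ v = μ • v) (hgw : g *ᵥ w = ν • w) (u : Fin 2 → k) (hu : u ≠ 0) (a : k)
    (hgu : g *ᵥ u = a • u) :
    (a = μ ∧ ∃ s : k, s • v = u) ∨ (a = ν ∧ ∃ t : k, t • w = u) := by
  have hli : LinearIndependent k ![v, w] := by
    rw [LinearIndependent.pair_iff]
    intro s t hst
    have h2 : g *ᵥ (s • v + t • w) = 0 := by rw [hst]; simp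
    rw [Matrix.mulVec_add, Matrix.mulVec_smul, Matrix.mulVec_smul, hgv, hgw] at h2
    have h3 : (s * (μ - ν)) • v = 0 := by
      have : (s * (μ - ν)) • v = (s • μ • v + t • ν • w) - ν • (s • v + t • w) := by module
      rw [this, h2, hst]; simp
    have hs : s = 0 := by
      rcases smul_eq_zero.1 h3 with h | h
      · exact (mul_eq_zero.1 h).resolve_right (sub_ne_zero.2 hne)
      · exact absurd h hv
    subst hs
    refine ⟨rfl, ?_⟩
    simpa [hw] using hst
  have hspan := hli.span_eq_top_of_card_eq_finrank (by simp)
  have humem : u ∈ Submodule.span k (Set.range ![v, w]) := by rw [hspan]; trivial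
  rw [Matrix.range_cons, Matrix.range_cons, Matrix.range_empty, Set.union_empty,
    Set.singleton_union, Submodule.mem_span_pair] at humem
  obtain ⟨s, t, rfl⟩ := humem
  rw [Matrix.mulVec_add, Matrix.mulVec_smul, Matrix.mulVec_smul, hgv, hgw] at hgu
  have h3 : (s * (μ - a)) • v + (t * (ν - a)) • w = 0 := by
    have : (s * (μ - a)) • v + (t * (ν - a)) • w
      = (s • μ • v + t • ν • w) - a • (s • v + t • w) := by module
    rw [this, hgu, sub_self]
  obtain ⟨h4, h5⟩ := LinearIndependent.pair_iff.1 hli _ _ h3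
  by_cases hs : s = 0
  · right
    subst hs
    have ht : t ≠ 0 := by rintro rfl; simp at hu
    exact ⟨(sub_eq_zero.1 ((mul_eq_zero.1 h5).resolve_left ht)).symm, t, by simp⟩
  · left
    have ha := (sub_eq_zero.1 ((mul_eq_zero.1 h4).resolve_left hs)).symm
    subst ha
    have ht : t = 0 := (mul_eq_zero.1 h5).resolve_right (sub_ne_zero.2 hne.symm)
    exact ⟨rfl, s, by simp [ht]⟩

theorem det_eq_of_eig {k : Type*} [Field k] (g : Matrix (Fin 2) (Fin 2) k)
    (v w : Fin 2 → k) (μ ν : k) (hne : μ ≠ ν) (hv : v ≠ 0) (hw : w ≠ 0)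
    (hgv : g *ᵥ v = μ • v) (hgw : g *ᵥ w = ν • w) : g.det = μ * ν := by
  have key : ∀ (x : Fin 2 → k) (a : k), x ≠ 0 → g *ᵥ x = a • x →
      (g 0 0 - a) * (g 1 1 - a) - g 0 1 * g 1 0 = 0 := by
    intro x a hx hgx
    have : (g - a • (1 : Matrix (Fin 2) (Fin 2) k)).det = 0 := by
      rw [← Matrix.exists_mulVec_eq_zero_iff]
      refine ⟨x, hx, ?_⟩
      rw [Matrix.sub_mulVec, hgx, Matrix.smul_mulVec, Matrix.one_mulVec, sub_self]
    rw [Matrix.det_fin_two] at this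
    simpa using this
  have h1 := key v μ hv hgv
  have h2 := key w ν hw hgw
  rw [Matrix.det_fin_two]
  have h3 : g 0 0 + g 1 1 = μ + ν := by
    apply mul_left_cancel₀ (sub_ne_zero.2 hne)
    linear_combination h2 - h1
  linear_combination h1 + μ * h3

open MatrixGroups LinearAlgebra.Projectivization in
theorem exists_pow_scalar {k : Type*} [Field k] (g : GL (Fin 2) k)
    (hg : IsOfFinOrder (Matrix.ProjGenLinGroup.mk g)) :
    ∃ m : ℕ, m ≠ 0 ∧ ∃ c : k, c ≠ 0 ∧ (g : Matrix (Fin 2) (Fin 2) k) ^ m = c • 1 := by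
  obtain ⟨m, hm, h⟩ := isOfFinOrder_iff_pow_eq_one.1 hg
  refine ⟨m, hm.ne', ?_⟩
  rw [← map_pow, Matrix.ProjGenLinGroup.mk_eq_one,
    Matrix.GeneralLinearGroup.center_eq_range_scalar] at h
  obtain ⟨u, hu⟩ := h
  refine ⟨u, u.ne_zero, ?_⟩
  have := congrArg Units.val hu
  rw [Units.val_pow_eq_pow_val] at this
  rw [← this]
  ext i j
  simp [Matrix.one_apply, Matrix.diagonal_apply]

open MatrixGroups LinearAlgebra.Projectivization in
theorem mk_diag {k : Type*} [Field k] [IsAlgClosed k] [CharZero k] (g : GL (Fin 2) k)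
    (hg : IsOfFinOrder (Matrix.ProjGenLinGroup.mk g)) (h1 : Matrix.ProjGenLinGroup.mk g ≠ 1) :
    ∃ (v w : Fin 2 → k) (μ ν : k), μ ≠ ν ∧ v ≠ 0 ∧ w ≠ 0 ∧
      g.val *ᵥ v = μ • v ∧ g.val *ᵥ w = ν • w := by
  obtain ⟨m, hm, c, hc, h⟩ := exists_pow_scalar g hg
  refine (diag_or_scalar g.val m hm c hc h).resolve_left ?_
  rintro ⟨a, ha⟩
  apply h1
  rw [Matrix.ProjGenLinGroup.mk_eq_one,
    Matrix.GeneralLinearGroup.mem_center_iff_val_mem_range_scalar]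
  exact ⟨a, ha.symm⟩

open MatrixGroups LinearAlgebra.Projectivization in
theorem mk_smul_eq_iff {k : Type*} [Field k] (g : GL (Fin 2) k) (u : Fin 2 → k) (hu : u ≠ 0) :
    Matrix.ProjGenLinGroup.mk g • Projectivization.mk k u hu = Projectivization.mk k u hu ↔
      ∃ a : k, g.val *ᵥ u = a • u := by
  rw [Projectivization.PGL.mk_smul_mk, Projectivization.mk_eq_mk_iff']
  exact exists_congr fun a => eq_comm

open MatrixGroups LinearAlgebra.Projectivization in
theorem fixed_two {k : Type*} [Field k] [IsAlgClosed k] [CharZero k] (g : PGL(Fin 2, k))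
    (hg : IsOfFinOrder g) (h1 : g ≠ 1) :
    ∃ p q : Projectivization k (Fin 2 → k), p ≠ q ∧ ∀ x, g • x = x ↔ x = p ∨ x = q := by
  induction g using Matrix.ProjGenLinGroup.induction_on with | mk g =>
  obtain ⟨v, w, μ, ν, hne, hv, hw, hgv, hgw⟩ := mk_diag g hg h1
  refine ⟨Projectivization.mk k v hv, Projectivization.mk k w hw, ?_, ?_⟩
  · intro h
    rw [Projectivization.mk_eq_mk_iff'] at h
    obtain ⟨a, ha⟩ := h
    rw [← ha, Matrix.mulVec_smul, hgw, ha, smul_comm, ha, ← sub_eq_zero, ← sub_smul] at hgv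
    rcases smul_eq_zero.1 hgv with h | h
    · exact hne (sub_eq_zero.1 h).symm
    · exact hv h
  · intro x
    induction x using Projectivization.ind with | h u hu =>
    rw [mk_smul_eq_iff, Projectivization.mk_eq_mk_iff', Projectivization.mk_eq_mk_iff']
    constructor
    · rintro ⟨a, ha⟩
      exact (eig_decomp g.val v w μ ν hne hv hw hgv hgw u hu a ha).imp And.right And.right
    · rintro (⟨s, rfl⟩ | ⟨s, rfl⟩)
      · exact ⟨μ, by rw [Matrix.mulVec_smul, hgv, smul_comm]⟩
      · exact ⟨ν, by rw [Matrix.mulVec_smul, hgw, smul_comm]⟩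

/-- The multiplier function `λ² / det` with `λ` read off through a linear functional. -/
noncomputable def multFun {k : Type*} [Field k] (l : (Fin 2 → k) →ₗ[k] k) (v : Fin 2 → k)
    (g : GL (Fin 2) k) : k := (l (g.val *ᵥ v)) ^ 2 / g.val.det

theorem multFun_eig {k : Type*} [Field k] (l : (Fin 2 → k) →ₗ[k] k) (v : Fin 2 → k) (hl : l v = 1)
    (g : GL (Fin 2) k) (a : k) (ha : g.val *ᵥ v = a • v) : multFun l v g = a ^ 2 / g.val.det := by
  simp [multFun, ha, hl]

theorem multFun_mul {k : Type*} [Field k] (l : (Fin 2 → k) →ₗ[k] k) (v : Fin 2 → k) (hl : l v = 1)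
    (g h : GL (Fin 2) k) (a b : k) (ha : g.val *ᵥ v = a • v) (hb : h.val *ᵥ v = b • v) :
    multFun l v (g * h) = multFun l v g * multFun l v h := by
  rw [multFun_eig l v hl g a ha, multFun_eig l v hl h b hb, multFun_eig l v hl (g * h) (a * b)]
  · rw [Units.val_mul, Matrix.det_mul]; ring
  · rw [Units.val_mul, ← Matrix.mulVec_mulVec, hb, Matrix.mulVec_smul, ha, smul_smul, mul_comm]

theorem multFun_scalar {k : Type*} [Field k] (l : (Fin 2 → k) →ₗ[k] k) (v : Fin 2 → k)
    (g : GL (Fin 2) k) (u : kˣ) :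
    multFun l v (g * Matrix.GeneralLinearGroup.scalar (Fin 2) u) = multFun l v g := by
  have h1 : (Matrix.GeneralLinearGroup.scalar (Fin 2) u).val = (u : k) • 1 := by
    ext i j
    simp [Matrix.one_apply, Matrix.diagonal_apply]
  have hu : (u : k) ≠ 0 := u.ne_zero
  unfold multFun
  rw [Units.val_mul, h1, Matrix.mul_smul, mul_one, Matrix.smul_mulVec, map_smul, Matrix.det_smul]
  simp only [smul_eq_mul, Fintype.card_fin]
  rw [mul_pow, mul_div_mul_left _ _ (pow_ne_zero 2 hu)]

open MatrixGroups LinearAlgebra.Projectivization in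
theorem stab_cyclic {k : Type*} [Field k] [IsAlgClosed k] [CharZero k] {S : Type*} [Group S]
    [Finite S] (ι : S →* PGL(Fin 2, k)) (hι : Function.Injective ι)
    (x : Projectivization k (Fin 2 → k)) (hx : ∀ s, ι s • x = x) : IsCyclic S := by
  induction x using Projectivization.ind with | h v hv =>
  obtain ⟨l, hl⟩ : ∃ l : (Fin 2 → k) →ₗ[k] k, l v = 1 := by
    obtain ⟨i, hi⟩ := Function.ne_iff.1 hv
    exact ⟨(v i)⁻¹ • LinearMap.proj i, by simpa using inv_mul_cancel₀ hi⟩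
  have hrep : ∀ s, ∃ g : GL (Fin 2) k, Matrix.ProjGenLinGroup.mk g = ι s :=
    fun s => Matrix.ProjGenLinGroup.mk_surjective (ι s)
  choose R hR using hrep
  have hev : ∀ s, ∃ a : k, (R s).val *ᵥ v = a • v := by
    intro s
    rw [← mk_smul_eq_iff _ v hv, hR]
    exact hx s
  choose A hA using hev
  have hmul : ∀ s t, multFun l v (R (s * t)) = multFun l v (R s) * multFun l v (R t) := by
    intro s t
    rw [← multFun_mul l v hl (R s) (R t) _ _ (hA s) (hA t)]
    have : Matrix.ProjGenLinGroup.mk (R s * R t) = Matrix.ProjGenLinGroup.mk (R (s * t)) := by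
      rw [map_mul, hR, hR, hR, map_mul]
    obtain ⟨u, hu⟩ := Matrix.ProjGenLinGroup.mk_eq_mk_iff.1 this
    rw [← hu, multFun_scalar]
  have hdet : ∀ g : GL (Fin 2) k, g.val.det ≠ 0 := fun g =>
    ((Matrix.isUnit_iff_isUnit_det _).1 g.isUnit).ne_zero
  have hone : multFun l v (R 1) = 1 := by
    have : Matrix.ProjGenLinGroup.mk 1 = Matrix.ProjGenLinGroup.mk (R 1) := by
      rw [hR, map_one, map_one]
    obtain ⟨u, hu⟩ := Matrix.ProjGenLinGroup.mk_eq_mk_iff.1 this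
    rw [← hu, multFun_scalar]
    simp [multFun, hl]
  let f : S →* k :=
    { toFun := fun s => multFun l v (R s)
      map_one' := hone
      map_mul' := hmul }
  apply isCyclic_of_injective_ringHom f
  have hker : ∀ s, f s = 1 → s = 1 := by
    intro s hs
    by_contra hs1
    have hfin : IsOfFinOrder (Matrix.ProjGenLinGroup.mk (R s)) := by
      rw [hR]; exact ι.isOfFinOrder (isOfFinOrder_of_finite s)
    have hne1 : Matrix.ProjGenLinGroup.mk (R s) ≠ 1 := by
      rw [hR]
      intro h
      exact hs1 (hι (h.trans ι.map_one.symm))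
    obtain ⟨v', w', μ, ν, hne, hv', hw', hgv, hgw⟩ := mk_diag (R s) hfin hne1
    have hd := det_eq_of_eig _ v' w' μ ν hne hv' hw' hgv hgw
    have hd0 := hdet (R s)
    have hfs : multFun l v (R s) = 1 := hs
    rw [multFun_eig l v hl _ _ (hA s), div_eq_one_iff_eq hd0, hd] at hfs
    rw [hd] at hd0
    rcases eig_decomp _ v' w' μ ν hne hv' hw' hgv hgw v hv _ (hA s) with ⟨h, -⟩ | ⟨h, -⟩
    · rw [h, sq] at hfs
      exact hne (mul_left_cancel₀ (left_ne_zero_of_mul hd0) hfs)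
    · rw [h, sq] at hfs
      exact hne (mul_right_cancel₀ (right_ne_zero_of_mul hd0) hfs).symm
  intro s t hst
  have h2 : f (s * t⁻¹) = 1 := by
    rw [map_mul, hst, ← map_mul, mul_inv_cancel, map_one]
  exact mul_inv_eq_one.1 (hker _ h2)

open MatrixGroups LinearAlgebra.Projectivization in
theorem classification_of_injective {k : Type*} [Field k] [IsAlgClosed k] [CharZero k]
    {G : Type*} [Group G] [Finite G] (ι : G →* PGL(Fin 2, k)) (hι : Function.Injective ι) :
    Nonempty (G ≃* alternatingGroup (Fin 5)) ∨
    Nonempty (G ≃* Equiv.Perm (Fin 4)) ∨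
    Nonempty (G ≃* alternatingGroup (Fin 4)) ∨
    (∃ ν : ℕ, 2 ≤ ν ∧ Nonempty (G ≃* DihedralGroup ν)) ∨
    (∃ ν : ℕ, 1 ≤ ν ∧ Nonempty (G ≃* Multiplicative (ZMod ν))) := by
  let _ : MulAction G (Projectivization k (Fin 2 → k)) := MulAction.compHom _ ι
  have hact : ∀ (g : G) (x : Projectivization k (Fin 2 → k)), g • x = ι g • x := fun _ _ => rfl
  apply abstract_classification' (X := Projectivization k (Fin 2 → k))
  · intro g hg
    simp only [hact]
    exact fixed_two (ι g) (ι.isOfFinOrder (isOfFinOrder_of_finite g))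
      (fun h => hg (hι (h.trans ι.map_one.symm)))
  · intro x
    apply stab_cyclic (ι.comp (MulAction.stabilizer G x).subtype)
      (hι.comp (Subgroup.subtype_injective _)) x
    rintro ⟨s, hs⟩
    exact hs

/-- every finite subgroup of `PGL(2,k)`, for `k` algebraically closed of
characteristic zero, is isomorphic to `A₅`, `S₄`, `A₄`, a dihedral group of order `2ν`
(`ν ≥ 2`), or a cyclic group of order `ν` (`ν ≥ 1`). -/
theorem finite_subgroup_PGL2_classification
    {k : Type*} [Field k] [IsAlgClosed k] [CharZero k]
    (G : Subgroup (PGL 2 k)) (hG : Finite G) :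
    Nonempty (G ≃* alternatingGroup (Fin 5)) ∨
    Nonempty (G ≃* Equiv.Perm (Fin 4)) ∨
    Nonempty (G ≃* alternatingGroup (Fin 4)) ∨
    (∃ ν : ℕ, 2 ≤ ν ∧ Nonempty (G ≃* DihedralGroup ν)) ∨
    (∃ ν : ℕ, 1 ≤ ν ∧ Nonempty (G ≃* Multiplicative (ZMod ν))) := by
  let j : PGL 2 k →* Matrix.ProjGenLinGroup (Fin 2) k :=
    QuotientGroup.lift _ Matrix.ProjGenLinGroup.mk (by rw [Matrix.ProjGenLinGroup.ker_mk])
  have hj : Function.Injective j :=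
    (QuotientGroup.injective_lift_iff _ _ _).2 Matrix.ProjGenLinGroup.ker_mk.symm
  exact classification_of_injective (j.comp G.subtype) (hj.comp (Subgroup.subtype_injective G))
end
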